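/- arXiv:1310.2343 — 11 statements merged into one kernel-verified Lean document; each statement's English description precedes it below -/
import Mathlib

section
/- For every ε > 0, the sum S(ε) = ∑_{n=0}^∞ (1 − Φ(ε/θ(n))) is finite if and only if the sum S'(ε) = ∑_{n=0}^∞ θ(n)·exp(−ε²/(2·θ(n)²)) is finite. -/
/-- The standard normal distribution function. -/
noncomputable def Phi (x : ℝ) : ℝ :=
  (Real.sqrt (2 * Real.pi))⁻¹ * ∫ u in Set.Iic x, Real.exp (-(u ^ 2) / 2)

/-- `theta σ n ≥ 0` with `(theta σ n)^2 = ∫_n^{n+1} σ(s)^2 ds`. -/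
noncomputable def theta (σ : ℝ → ℝ) (n : ℕ) : ℝ :=
  Real.sqrt (∫ s in (n : ℝ)..((n : ℝ) + 1), (σ s) ^ 2)

theorem integrable_exp_neg_sq_div_two :
    MeasureTheory.Integrable fun u : ℝ => Real.exp (-(u ^ 2) / 2) := by
  refine (integrable_exp_neg_mul_sq (b := 1 / 2) (by norm_num)).congr (.of_forall fun u => ?_)
  ring_nf

theorem integral_exp_neg_sq_div_two :
    ∫ u : ℝ, Real.exp (-(u ^ 2) / 2) = √(2 * Real.pi) := by
  have h := integral_gaussian (1 / 2)
  rw [show Real.pi / (1 / 2) = 2 * Real.pi by ring] at h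
  rw [← h]
  congr 1 with u
  ring_nf

theorem one_sub_Phi (x : ℝ) :
    1 - Phi x = (√(2 * Real.pi))⁻¹ * ∫ u in Set.Ioi x, Real.exp (-(u ^ 2) / 2) := by
  have h := intervalIntegral.integral_Iic_add_Ioi (b := x)
    integrable_exp_neg_sq_div_two.integrableOn integrable_exp_neg_sq_div_two.integrableOn
  rw [integral_exp_neg_sq_div_two] at h
  have hpos : 0 < √(2 * Real.pi) := by positivity
  rw [Phi, eq_sub_of_add_eq' h, mul_sub, inv_mul_cancel₀ hpos.ne']

theorem integral_Ioi_exp_neg_sq_div_two_le {x : ℝ} (hx : 0 < x) :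
    ∫ u in Set.Ioi x, Real.exp (-(u ^ 2) / 2) ≤ Real.exp (-(x ^ 2) / 2) / x := by
  calc ∫ u in Set.Ioi x, Real.exp (-(u ^ 2) / 2)
      ≤ ∫ u in Set.Ioi x, Real.exp (x ^ 2 / 2) * Real.exp (-x * u) := by
        refine MeasureTheory.integral_mono integrable_exp_neg_sq_div_two.integrableOn
          ((integrableOn_exp_mul_Ioi (neg_neg_of_pos hx) x).const_mul _) fun u => ?_
        simp only [← Real.exp_add]
        gcongr
        nlinarith [sq_nonneg (u - x)]
    _ = Real.exp (-(x ^ 2) / 2) / x := by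
        rw [MeasureTheory.integral_const_mul, integral_exp_mul_Ioi (neg_neg_of_pos hx),
          neg_div_neg_eq, ← mul_div_assoc, ← Real.exp_add]
        ring_nf

theorem le_integral_Ioi_exp_neg_sq_div_two {x : ℝ} (hx : 1 ≤ x) :
    Real.exp (-(3 / 2)) * (Real.exp (-(x ^ 2) / 2) / x) ≤
      ∫ u in Set.Ioi x, Real.exp (-(u ^ 2) / 2) := by
  have hx0 : 0 < x := by linarith
  have hinv : x * x⁻¹ = 1 := mul_inv_cancel₀ hx0.ne'
  have hinv0 : 0 < x⁻¹ := inv_pos.2 hx0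
  have hinv1 : x⁻¹ ≤ 1 := inv_le_one_of_one_le₀ hx
  calc Real.exp (-(3 / 2)) * (Real.exp (-(x ^ 2) / 2) / x)
      = ∫ _ in Set.Ioc x (x + x⁻¹), Real.exp (-(3 / 2)) * Real.exp (-(x ^ 2) / 2) := by
        simp [hinv0.le]
        ring
    _ ≤ ∫ u in Set.Ioc x (x + x⁻¹), Real.exp (-(u ^ 2) / 2) := by
        refine MeasureTheory.setIntegral_mono_on (MeasureTheory.integrableOn_const (by simp))
          integrable_exp_neg_sq_div_two.integrableOn measurableSet_Ioc fun u hu => ?_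
        rw [← Real.exp_add]
        gcongr
        have hsq : u ^ 2 ≤ (x + x⁻¹) ^ 2 := pow_le_pow_left₀ (by linarith [hu.1]) hu.2 2
        nlinarith
    _ ≤ ∫ u in Set.Ioi x, Real.exp (-(u ^ 2) / 2) :=
        MeasureTheory.setIntegral_mono_set integrable_exp_neg_sq_div_two.integrableOn
          (.of_forall fun u => (Real.exp_pos _).le)
          (LE.le.eventuallyLE Set.Ioc_subset_Ioi_self)

theorem integral_Ioi_exp_neg_sq_div_two_antitone :
    Antitone fun x : ℝ => ∫ u in Set.Ioi x, Real.exp (-(u ^ 2) / 2) := fun _ _ hxy =>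
  MeasureTheory.setIntegral_mono_set integrable_exp_neg_sq_div_two.integrableOn
    (.of_forall fun _ => (Real.exp_pos _).le)
    (LE.le.eventuallyLE (Set.Ioi_subset_Ioi hxy))

theorem mul_exp_neg_sq_div_eq {ε t : ℝ} (hε : ε ≠ 0) (ht : t ≠ 0) :
    t * Real.exp (-(ε ^ 2) / (2 * t ^ 2)) =
      ε * (Real.exp (-((ε / t) ^ 2) / 2) / (ε / t)) := by
  rw [show -(ε ^ 2) / (2 * t ^ 2) = -((ε / t) ^ 2) / 2 by field_simp]
  field_simp

/-- For every `ε > 0`, `S(ε) = ∑ (1 - Φ(ε/θ(n)))` is finite if and only if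
`S'(ε) = ∑ θ(n)·exp(-ε²/(2θ(n)²))` is finite (summands interpreted as `0` when `θ(n) = 0`). -/
theorem stmt_0 (σ : ℝ → ℝ) (hσ : ContinuousOn σ (Set.Ici 0)) (ε : ℝ) (hε : 0 < ε) :
    Summable (fun n : ℕ => if theta σ n = 0 then 0 else 1 - Phi (ε / theta σ n)) ↔
      Summable (fun n : ℕ =>
        theta σ n * Real.exp (-(ε ^ 2) / (2 * (theta σ n) ^ 2))) := by
  have hθ (n : ℕ) : 0 ≤ theta σ n := Real.sqrt_nonneg _
  have hc : 0 < (√(2 * Real.pi))⁻¹ := by positivity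
  have htail (x : ℝ) : 0 ≤ ∫ u in Set.Ioi x, Real.exp (-(u ^ 2) / 2) :=
    MeasureTheory.integral_nonneg fun u => (Real.exp_pos _).le
  simp only [one_sub_Phi]
  constructor
  · intro h
    have hδ : 0 < (√(2 * Real.pi))⁻¹ * ∫ u in Set.Ioi (1 : ℝ), Real.exp (-(u ^ 2) / 2) :=
      mul_pos hc (lt_of_lt_of_le (by positivity) (le_integral_Ioi_exp_neg_sq_div_two le_rfl))
    refine (h.mul_left (ε * √(2 * Real.pi) * Real.exp (3 / 2))).of_norm_bounded_eventually_nat ?_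
    filter_upwards [h.tendsto_atTop_zero.eventually_lt_const hδ] with n hn
    rw [Real.norm_of_nonneg (mul_nonneg (hθ n) (Real.exp_pos _).le)]
    by_cases h0 : theta σ n = 0
    · simp [h0]
    rw [if_neg h0] at hn ⊢
    have hx : 1 ≤ ε / theta σ n := by
      by_contra! hlt
      exact hn.not_ge (mul_le_mul_of_nonneg_left
        (integral_Ioi_exp_neg_sq_div_two_antitone hlt.le) hc.le)
    have hlow := le_integral_Ioi_exp_neg_sq_div_two hx
    rw [Real.exp_neg, inv_mul_le_iff₀ (Real.exp_pos _)] at hlow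
    rw [mul_exp_neg_sq_div_eq hε.ne' h0]
    refine (mul_le_mul_of_nonneg_left hlow hε.le).trans_eq ?_
    field_simp
  · intro h
    refine (h.mul_left ((√(2 * Real.pi))⁻¹ / ε)).of_nonneg_of_le (fun n => ?_) fun n => ?_
    · split_ifs
      exacts [le_rfl, mul_nonneg hc.le (htail _)]
    · split_ifs with h0
      · simp [h0]
      rw [mul_exp_neg_sq_div_eq hε.ne' h0, ← mul_assoc, div_mul_cancel₀ _ hε.ne']
      exact mul_le_mul_of_nonneg_left (integral_Ioi_exp_neg_sq_div_two_le
        (div_pos hε ((hθ n).lt_of_ne' h0))) hc.le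
end

section
/- If σ(t)²·log t → 0 as t → ∞, then S'(ε) < +∞ for every ε > 0. -/
/-- A pointwise bound on `σ ^ 2` over `(n, ∞)` bounds `(theta σ n) ^ 2`. -/
theorem theta_sq_le (σ : ℝ → ℝ) (n : ℕ) (C : ℝ) (hC : 0 ≤ C)
    (h : ∀ s : ℝ, (n : ℝ) < s → (σ s) ^ 2 ≤ C) : (theta σ n) ^ 2 ≤ C := by
  have hI : ‖∫ s in (n : ℝ)..((n : ℝ) + 1), (σ s) ^ 2‖ ≤ C * |(n : ℝ) + 1 - n| := by
    refine intervalIntegral.norm_integral_le_of_norm_le_const fun s hs => ?_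
    rw [Set.uIoc_of_le (by linarith)] at hs
    rw [Real.norm_of_nonneg (sq_nonneg _)]
    exact h s hs.1
  rw [add_sub_cancel_left, abs_one, mul_one] at hI
  have hle : theta σ n ≤ Real.sqrt C := Real.sqrt_le_sqrt ((le_abs_self _).trans hI)
  calc (theta σ n) ^ 2 ≤ (Real.sqrt C) ^ 2 := pow_le_pow_left₀ (Real.sqrt_nonneg _) hle 2
    _ = C := Real.sq_sqrt hC

/-- If `x ^ 2 ≤ ε ^ 2 / (4 log n)`, the Gaussian-type term at `x` is at most `ε / n ^ 2`. -/
theorem mul_exp_neg_div_sq_le {x ε t : ℝ} (hx : 0 ≤ x) (hε : 0 < ε) (ht : 0 < t)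
    (hlog : 1 ≤ Real.log t) (h : x ^ 2 ≤ ε ^ 2 / 4 / Real.log t) :
    x * Real.exp (-(ε ^ 2) / (2 * x ^ 2)) ≤ ε * (1 / t ^ 2) := by
  rcases hx.eq_or_lt with rfl | hx0
  · rw [zero_mul]
    positivity
  have hL : 0 < Real.log t := by linarith
  rw [le_div_iff₀ hL] at h
  have hxε : x ≤ ε := by
    refine (sq_le_sq₀ hx hε.le).1 ?_
    nlinarith [sq_nonneg x, sq_nonneg ε]
  refine mul_le_mul hxε ?_ (Real.exp_nonneg _) hε.le
  have ht2 : 1 / t ^ 2 = Real.exp (-(2 * Real.log t)) := by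
    rw [Real.exp_neg, two_mul, Real.exp_add, Real.exp_log ht, one_div, sq]
  rw [ht2, Real.exp_le_exp, div_le_iff₀ (by positivity)]
  nlinarith

/-- If `σ(t)²·log t → 0` as `t → ∞`, then `S'(ε) < +∞` for every `ε > 0`. -/
theorem stmt_2 (σ : ℝ → ℝ) (hσ : ContinuousOn σ (Set.Ici 0))
    (hlim : Filter.Tendsto (fun t : ℝ => (σ t) ^ 2 * Real.log t) Filter.atTop (nhds 0)) :
    ∀ ε : ℝ, 0 < ε → Summable (fun n : ℕ =>
      theta σ n * Real.exp (-(ε ^ 2) / (2 * (theta σ n) ^ 2))) := by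
  intro ε hε
  have hs : Summable fun n : ℕ => ε * (1 / (n : ℝ) ^ 2) :=
    (Real.summable_one_div_nat_pow.2 one_lt_two).mul_left ε
  refine hs.of_norm_bounded_eventually_nat ?_
  obtain ⟨T, hT⟩ := Filter.eventually_atTop.1
    (hlim.eventually (Iio_mem_nhds (show (0 : ℝ) < ε ^ 2 / 4 by positivity)))
  have hlog := (Real.tendsto_log_atTop.comp tendsto_natCast_atTop_atTop).eventually_ge_atTop
    (1 : ℝ)
  filter_upwards [hlog, tendsto_natCast_atTop_atTop.eventually_ge_atTop T,
    Filter.eventually_gt_atTop 0] with n hn hnT hn0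
  have hn' : (0 : ℝ) < n := Nat.cast_pos.2 hn0
  have hL : 1 ≤ Real.log (n : ℝ) := hn
  have hθ : 0 ≤ theta σ n := Real.sqrt_nonneg _
  rw [Real.norm_of_nonneg (mul_nonneg hθ (Real.exp_nonneg _))]
  refine mul_exp_neg_div_sq_le hθ hε hn' hL (theta_sq_le σ n _ (by positivity) fun s hs => ?_)
  rw [le_div_iff₀ (by linarith)]
  calc (σ s) ^ 2 * Real.log n ≤ (σ s) ^ 2 * Real.log s :=
        mul_le_mul_of_nonneg_left (Real.log_le_log hn' hs.le) (sq_nonneg _)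
    _ ≤ ε ^ 2 / 4 := (hT s (hnT.trans hs.le)).le
end

section
/- If σ(t)²·log t → L as t → ∞ for some L ∈ (0,∞), then, with ε' = √(2L), one has S'(ε) < +∞ for every ε > ε' and S'(ε) = +∞ for every ε with 0 < ε < ε'. -/
open Filter Topology Set

lemma intervalIntegrable_sq_of_continuousOn_Ici {σ : ℝ → ℝ} (hσ : ContinuousOn σ (Ici 0)) (n : ℕ) :
    IntervalIntegrable (fun s => σ s ^ 2) MeasureTheory.volume (n : ℝ) ((n : ℝ) + 1) := by
  apply ContinuousOn.intervalIntegrable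
  refine (hσ.mono ?_).pow 2
  rw [uIcc_of_le (by linarith)]
  exact fun x hx => le_trans (Nat.cast_nonneg n) hx.1

lemma theta_nonneg (σ : ℝ → ℝ) (n : ℕ) : 0 ≤ theta σ n := Real.sqrt_nonneg _

lemma theta_sq (σ : ℝ → ℝ) (n : ℕ) :
    theta σ n ^ 2 = ∫ s in (n : ℝ)..((n : ℝ) + 1), σ s ^ 2 :=
  Real.sq_sqrt (intervalIntegral.integral_nonneg (by linarith) fun _ _ => sq_nonneg _)

lemma eventually_div_log_le_theta_sq {σ : ℝ → ℝ} (hσ : ContinuousOn σ (Ici 0)) {a : ℝ}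
    (ha : 0 ≤ a) (h : ∀ᶠ t in atTop, a ≤ σ t ^ 2 * Real.log t) :
    ∀ᶠ n : ℕ in atTop, a / Real.log ((n : ℝ) + 1) ≤ theta σ n ^ 2 := by
  obtain ⟨T, hT⟩ := eventually_atTop.1 h
  filter_upwards [tendsto_natCast_atTop_atTop.eventually_ge_atTop T,
    tendsto_natCast_atTop_atTop.eventually_gt_atTop (1 : ℝ)] with n hn hn1
  have key := intervalIntegral.integral_mono_on (μ := MeasureTheory.volume)
    (show (n : ℝ) ≤ (n : ℝ) + 1 by linarith)
    (intervalIntegrable_const (c := a / Real.log ((n : ℝ) + 1)))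
    (intervalIntegrable_sq_of_continuousOn_Ici hσ n) (fun t ht => by
      have hlog : 0 < Real.log t := Real.log_pos (by linarith [ht.1])
      calc a / Real.log ((n : ℝ) + 1) ≤ a / Real.log t := by
            gcongr
            · linarith [ht.1]
            · exact ht.2
        _ ≤ σ t ^ 2 := by
            rw [div_le_iff₀ hlog]
            exact hT t (hn.trans ht.1))
  rw [theta_sq]
  simpa using key

lemma eventually_theta_sq_le_div_log {σ : ℝ → ℝ} (hσ : ContinuousOn σ (Ici 0)) {b : ℝ}
    (hb : 0 ≤ b) (h : ∀ᶠ t in atTop, σ t ^ 2 * Real.log t ≤ b) :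
    ∀ᶠ n : ℕ in atTop, theta σ n ^ 2 ≤ b / Real.log n := by
  obtain ⟨T, hT⟩ := eventually_atTop.1 h
  filter_upwards [tendsto_natCast_atTop_atTop.eventually_ge_atTop T,
    tendsto_natCast_atTop_atTop.eventually_gt_atTop (1 : ℝ)] with n hn hn1
  have hlogn : 0 < Real.log n := Real.log_pos hn1
  have key := intervalIntegral.integral_mono_on (μ := MeasureTheory.volume)
    (show (n : ℝ) ≤ (n : ℝ) + 1 by linarith)
    (intervalIntegrable_sq_of_continuousOn_Ici hσ n)
    (intervalIntegrable_const (c := b / Real.log n)) (fun t ht => by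
      have hlog : 0 < Real.log t := Real.log_pos (by linarith [ht.1])
      calc σ t ^ 2 ≤ b / Real.log t := by
            rw [le_div_iff₀ hlog]
            exact hT t (hn.trans ht.1)
        _ ≤ b / Real.log n := by
            gcongr
            exact ht.1)
  rw [theta_sq]
  simpa using key

/-- If `b < ε² / 2` dominates `σ(t)² log t` eventually, the series is dominated by a `p`-series
with `p = ε² / (2b) > 1`. -/
lemma summable_theta_mul_exp {σ : ℝ → ℝ} (hσ : ContinuousOn σ (Ici 0)) {b ε : ℝ}
    (hb : 0 < b) (hbε : 2 * b < ε ^ 2) (h : ∀ᶠ t in atTop, σ t ^ 2 * Real.log t ≤ b) :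
    Summable (fun n : ℕ => theta σ n * Real.exp (-(ε ^ 2) / (2 * (theta σ n) ^ 2))) := by
  have hp : 1 < ε ^ 2 / (2 * b) := by
    rw [lt_div_iff₀ (by positivity)]
    linarith
  have hsum : Summable fun n : ℕ => √b * (n : ℝ) ^ (-(ε ^ 2 / (2 * b))) :=
    (Real.summable_nat_rpow.2 (by linarith)).mul_left _
  refine hsum.of_norm_bounded_eventually_nat ?_
  filter_upwards [eventually_theta_sq_le_div_log hσ hb.le h,
    tendsto_natCast_atTop_atTop.eventually_ge_atTop (Real.exp 1)] with n hn hne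
  have hn0 : (0 : ℝ) < n := (Real.exp_pos 1).trans_le hne
  have hlog : 1 ≤ Real.log n := (Real.le_log_iff_exp_le hn0).2 hne
  rw [Real.norm_of_nonneg (mul_nonneg (theta_nonneg σ n) (Real.exp_pos _).le)]
  rcases (theta_nonneg σ n).eq_or_lt with h0 | hpos
  · rw [← h0, zero_mul]
    positivity
  have hθb : theta σ n ≤ √b :=
    Real.le_sqrt_of_sq_le (hn.trans (div_le_self hb.le hlog))
  have hexp : Real.exp (-(ε ^ 2) / (2 * (theta σ n) ^ 2)) ≤ (n : ℝ) ^ (-(ε ^ 2 / (2 * b))) := by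
    rw [Real.rpow_def_of_pos hn0, Real.exp_le_exp, neg_div, mul_neg, neg_le_neg_iff,
      ← mul_div_assoc, div_le_div_iff₀ (by positivity) (by positivity)]
    rw [le_div_iff₀ (by linarith)] at hn
    nlinarith [mul_le_mul_of_nonneg_left hn (sq_nonneg ε)]
  exact mul_le_mul hθb hexp (Real.exp_pos _).le (Real.sqrt_nonneg b)

/-- If `a > ε² / 2` is eventually dominated by `σ(t)² log t`, the series dominates a multiple of
the harmonic series. -/
lemma not_summable_theta_mul_exp {σ : ℝ → ℝ} (hσ : ContinuousOn σ (Ici 0)) {a ε : ℝ}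
    (ha : 0 < a) (haε : ε ^ 2 < 2 * a) (h : ∀ᶠ t in atTop, a ≤ σ t ^ 2 * Real.log t) :
    ¬ Summable (fun n : ℕ => theta σ n * Real.exp (-(ε ^ 2) / (2 * (theta σ n) ^ 2))) := by
  intro hs
  set p : ℝ := ε ^ 2 / (2 * a) with hp
  have hp1 : p < 1 := by
    rw [hp, div_lt_one (by positivity)]
    exact haε
  set c : ℝ := 2 * (1 - p) with hc
  have hc0 : 0 < c := by linarith
  have hbound : ∀ᶠ n : ℕ in atTop, ‖√(a * c) * (1 / ((n : ℝ) + 1))‖ ≤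
      theta σ n * Real.exp (-(ε ^ 2) / (2 * (theta σ n) ^ 2)) := by
    filter_upwards [eventually_div_log_le_theta_sq hσ ha.le h, eventually_gt_atTop 0] with n hn hn0
    have hx1 : (1 : ℝ) < (n : ℝ) + 1 := by
      have : (0 : ℝ) < n := by exact_mod_cast hn0
      linarith
    set x : ℝ := (n : ℝ) + 1
    have hx0 : 0 < x := by linarith
    have hlog : 0 < Real.log x := Real.log_pos hx1
    have hθsq : 0 < theta σ n ^ 2 := (div_pos ha hlog).trans_le hn
    have hθ : √(a * c) * x ^ (-(1 - p)) ≤ theta σ n := by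
      refine (pow_le_pow_iff_left₀ (by positivity) (theta_nonneg σ n) two_ne_zero).1 ?_
      have hle : Real.log x ≤ x ^ c / c := Real.log_le_rpow_div hx0.le hc0
      calc (√(a * c) * x ^ (-(1 - p))) ^ 2 = a / (x ^ c / c) := by
            rw [mul_pow, Real.sq_sqrt (by positivity), ← Real.rpow_natCast, ← Real.rpow_mul hx0.le,
              show -(1 - p) * ((2 : ℕ) : ℝ) = -c by rw [hc]; push_cast; ring, Real.rpow_neg hx0.le]
            field_simp
        _ ≤ a / Real.log x := by gcongr
        _ ≤ _ := hn
    have hexp : x ^ (-p) ≤ Real.exp (-(ε ^ 2) / (2 * (theta σ n) ^ 2)) := by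
      rw [Real.rpow_def_of_pos hx0, Real.exp_le_exp, neg_div, mul_neg, neg_le_neg_iff, hp,
        ← mul_div_assoc, div_le_div_iff₀ (by positivity) (by positivity)]
      rw [div_le_iff₀ hlog] at hn
      nlinarith [mul_le_mul_of_nonneg_left hn (sq_nonneg ε)]
    rw [Real.norm_of_nonneg (by positivity)]
    calc √(a * c) * (1 / x) = √(a * c) * x ^ (-(1 - p)) * x ^ (-p) := by
          rw [mul_assoc, ← Real.rpow_add hx0, show -(1 - p) + -p = -1 by ring, Real.rpow_neg_one,
            one_div]
      _ ≤ _ := mul_le_mul hθ hexp (by positivity) (theta_nonneg σ n)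
  have hharm := hs.of_norm_bounded_eventually_nat hbound
  rw [summable_mul_left_iff (by positivity)] at hharm
  refine Real.not_summable_one_div_natCast ((summable_nat_add_iff 1).1 ?_)
  simpa using hharm

/-- If `σ(t)²·log t → L ∈ (0,∞)` as `t → ∞` then, with `ε' = √(2L)`, `S'(ε)` is finite
for every `ε > ε'` and infinite for every `0 < ε < ε'`. -/
theorem stmt_3 (σ : ℝ → ℝ) (hσ : ContinuousOn σ (Set.Ici 0)) (L : ℝ) (hL : 0 < L)
    (hlim : Filter.Tendsto (fun t : ℝ => (σ t) ^ 2 * Real.log t) Filter.atTop (nhds L)) :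
    (∀ ε : ℝ, Real.sqrt (2 * L) < ε → Summable (fun n : ℕ =>
      theta σ n * Real.exp (-(ε ^ 2) / (2 * (theta σ n) ^ 2)))) ∧
    (∀ ε : ℝ, 0 < ε → ε < Real.sqrt (2 * L) → ¬ Summable (fun n : ℕ =>
      theta σ n * Real.exp (-(ε ^ 2) / (2 * (theta σ n) ^ 2)))) := by
  refine ⟨fun ε hε => ?_, fun ε hε0 hε => ?_⟩
  · have hlt : L < ε ^ 2 / 2 := by
      have := (Real.sqrt_lt' ((Real.sqrt_nonneg _).trans_lt hε)).1 hε
      linarith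
    obtain ⟨b, hLb, hbε⟩ := exists_between hlt
    exact summable_theta_mul_exp hσ (hL.trans hLb) (by linarith)
      ((hlim.eventually_lt_const hLb).mono fun _ => le_of_lt)
  · have hlt : ε ^ 2 / 2 < L := by
      have := (Real.lt_sqrt hε0.le).1 hε
      linarith
    obtain ⟨a, haε, haL⟩ := exists_between hlt
    exact not_summable_theta_mul_exp hσ ((by positivity : 0 < ε ^ 2 / 2).trans haε) (by linarith)
      ((hlim.eventually_const_lt haL).mono fun _ => le_of_lt)
end

section
/- If σ(t)²·log t → +∞ as t → ∞, then S'(ε) = +∞ for every ε > 0. -/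
/-- A lower bound for `theta σ n ^ 2` from a pointwise lower bound on `[n, n + 1]`. -/
theorem le_theta_sq {σ : ℝ → ℝ} (hσ : ContinuousOn σ (Set.Ici 0)) {n : ℕ} {c : ℝ}
    (h : ∀ s ∈ Set.Icc (n : ℝ) (n + 1), c ≤ (σ s) ^ 2) : c ≤ theta σ n ^ 2 := by
  have hle : (n : ℝ) ≤ n + 1 := by linarith
  have hint : IntervalIntegrable (fun s => (σ s) ^ 2) MeasureTheory.volume (n : ℝ) (n + 1) := by
    refine ContinuousOn.intervalIntegrable_of_Icc hle ((hσ.mono fun s hs => ?_).pow 2)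
    exact (Nat.cast_nonneg n).trans hs.1
  have hmono := intervalIntegral.integral_mono_on hle intervalIntegrable_const hint h
  rw [theta, Real.sq_sqrt (intervalIntegral.integral_nonneg hle fun s _ => sq_nonneg _)]
  simpa using hmono

/-- If `ε² / log x ≤ θ²`, then `θ * exp (-ε² / (2 θ²))` is at least `ε / x`. -/
theorem div_le_mul_exp_of_div_log_le {ε θ x : ℝ} (hε : 0 < ε) (hθ : 0 ≤ θ) (hx : 1 < x)
    (h : ε ^ 2 / Real.log x ≤ θ ^ 2) :
    ε / x ≤ θ * Real.exp (-(ε ^ 2) / (2 * θ ^ 2)) := by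
  have hx0 : 0 < x := by linarith
  have hL : 0 < Real.log x := Real.log_pos hx
  have hLx : Real.log x ≤ x := (Real.log_le_sub_one_of_pos hx0).trans (by linarith)
  have hθ2 : 0 < θ ^ 2 := lt_of_lt_of_le (by positivity) h
  have hr : 0 < √x := Real.sqrt_pos.2 hx0
  have hθ_ge : ε / √x ≤ θ := by
    refine le_of_sq_le_sq ?_ hθ
    rw [div_pow, Real.sq_sqrt hx0.le]
    exact (div_le_div_of_nonneg_left (sq_nonneg ε) hL hLx).trans h
  have hexp : (√x)⁻¹ ≤ Real.exp (-(ε ^ 2) / (2 * θ ^ 2)) := by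
    have hsqrt : √x = Real.exp (Real.log x / 2) := by
      rw [Real.exp_half, Real.exp_log hx0]
    rw [hsqrt, ← Real.exp_neg, Real.exp_le_exp, neg_div, neg_le_neg_iff,
      div_le_div_iff₀ (by positivity) (by norm_num)]
    rw [div_le_iff₀ hL] at h
    linarith
  calc ε / x = ε / √x * (√x)⁻¹ := by
        rw [← div_eq_mul_inv, div_div, Real.mul_self_sqrt hx0.le]
    _ ≤ _ := mul_le_mul hθ_ge hexp (by positivity) hθ

/-- If `σ(t)²·log t → +∞` as `t → ∞`, then `S'(ε) = +∞` for every `ε > 0`. -/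
theorem stmt_4 (σ : ℝ → ℝ) (hσ : ContinuousOn σ (Set.Ici 0))
    (hlim : Filter.Tendsto (fun t : ℝ => (σ t) ^ 2 * Real.log t) Filter.atTop Filter.atTop) :
    ∀ ε : ℝ, 0 < ε → ¬ Summable (fun n : ℕ =>
      theta σ n * Real.exp (-(ε ^ 2) / (2 * (theta σ n) ^ 2))) := by
  intro ε hε hsum
  obtain ⟨T, hT⟩ := Filter.eventually_atTop.1 (hlim.eventually_ge_atTop (ε ^ 2))
  have hbound : ∀ᶠ n : ℕ in Filter.atTop, ‖ε / ((n + 1 : ℕ) : ℝ)‖ ≤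
      theta σ n * Real.exp (-(ε ^ 2) / (2 * (theta σ n) ^ 2)) := by
    filter_upwards [Filter.eventually_ge_atTop (max 2 ⌈T⌉₊)] with n hn
    have hn2 : (2 : ℝ) ≤ n := by exact_mod_cast (le_max_left _ _).trans hn
    have hnT : T ≤ n := Nat.ceil_le.1 ((le_max_right _ _).trans hn)
    rw [Real.norm_of_nonneg (by positivity)]
    push_cast
    refine div_le_mul_exp_of_div_log_le hε (Real.sqrt_nonneg _) (by linarith)
      (le_theta_sq hσ fun s hs => ?_)
    have hs1 : 1 < s := by linarith [hs.1]
    rw [div_le_iff₀ (Real.log_pos (by linarith))]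
    exact (hT s (hnT.trans hs.1)).trans
      (mul_le_mul_of_nonneg_left (Real.log_le_log (by linarith) hs.2) (sq_nonneg _))
  have hharm : Summable fun n : ℕ => ε / ((n + 1 : ℕ) : ℝ) :=
    hsum.of_norm_bounded_eventually_nat hbound
  have hharm' := ((summable_nat_add_iff (f := fun n : ℕ => ε / (n : ℝ)) 1).1 hharm).mul_left ε⁻¹
  refine Real.not_summable_one_div_natCast (hharm'.congr fun n => ?_)
  rw [← mul_div_assoc, inv_mul_cancel₀ hε.ne']
end

section
/- The following three statements are equivalent: (A) limsup_{t→∞} Σ²(t) ∈ (0,∞) (along real t); (B) limsup_{n→∞} Σ²(n) ∈ (0,∞) (along integers n); (C) limsup_{n→∞} θ(n)²·log n ∈ (0,∞). Moreover each of them implies that there exists ε' > 0 such that S'(ε) < +∞ for every ε > ε'. -/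
/-- `Σ²(t) = (∫_0^t e^{−2(t−s)} σ(s)² ds)·log t`. -/
noncomputable def Sig2 (σ : ℝ → ℝ) (t : ℝ) : ℝ :=
  (∫ s in (0 : ℝ)..t, Real.exp (-2 * (t - s)) * (σ s) ^ 2) * Real.log t

open Filter Real Topology

/-- A real function has a positive finite limsup in `EReal` iff it is eventually bounded by
some positive constant, but not by every positive constant. -/
theorem limsup_mem_Ioo_iff {ι : Type*} {l : Filter ι} {f : ι → ℝ} :
    (0 < limsup (fun i => ((f i : ℝ) : EReal)) l ∧ limsup (fun i => ((f i : ℝ) : EReal)) l < ⊤) ↔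
      (¬ ∀ c : ℝ, 0 < c → ∀ᶠ i in l, f i ≤ c) ∧ ∃ c : ℝ, 0 < c ∧ ∀ᶠ i in l, f i ≤ c := by
  have le_of_eventually {c : ℝ} (h : ∀ᶠ i in l, f i ≤ c) :
      limsup (fun i => ((f i : ℝ) : EReal)) l ≤ (c : EReal) :=
    limsup_le_of_le (h := h.mono fun i hi => EReal.coe_le_coe_iff.2 hi)
  have eventually_of_lt {c : ℝ} (h : limsup (fun i => ((f i : ℝ) : EReal)) l < (c : EReal)) :
      ∀ᶠ i in l, f i ≤ c :=
    (eventually_lt_of_limsup_lt h).mono fun i hi => (EReal.coe_lt_coe_iff.1 hi).le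
  refine and_congr ?_ ⟨fun h => ?_, fun ⟨c, _, h⟩ => (le_of_eventually h).trans_lt
    (EReal.coe_lt_top c)⟩
  · rw [← not_le, not_iff_not]
    refine ⟨fun h c hc => eventually_of_lt (h.trans_lt (EReal.coe_pos.2 hc)), fun h => ?_⟩
    refine le_of_forall_gt fun b hb => ?_
    obtain ⟨c, hc, hcb⟩ := EReal.lt_iff_exists_real_btwn.1 hb
    exact (le_of_eventually (h c (EReal.coe_pos.1 hc))).trans_lt hcb
  · obtain ⟨c, hc, -⟩ := EReal.lt_iff_exists_real_btwn.1 h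
    exact ⟨max c 1, by positivity,
      (eventually_of_lt hc).mono fun i hi => hi.trans (le_max_left _ _)⟩

/-- The limsups of two functions whose eventual upper bounds agree up to constant factors are
simultaneously positive and finite. -/
theorem limsup_mem_Ioo_congr {ι κ : Type*} {l : Filter ι} {m : Filter κ} {f : ι → ℝ} {g : κ → ℝ}
    {A B : ℝ} (hA : 0 < A) (hB : 0 < B)
    (hfg : ∀ c : ℝ, 0 < c → (∀ᶠ i in l, f i ≤ c) → ∀ᶠ i in m, g i ≤ A * c)
    (hgf : ∀ c : ℝ, 0 < c → (∀ᶠ i in m, g i ≤ c) → ∀ᶠ i in l, f i ≤ B * c) :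
    (0 < limsup (fun i => ((f i : ℝ) : EReal)) l ∧ limsup (fun i => ((f i : ℝ) : EReal)) l < ⊤) ↔
      (0 < limsup (fun i => ((g i : ℝ) : EReal)) m ∧
        limsup (fun i => ((g i : ℝ) : EReal)) m < ⊤) := by
  rw [limsup_mem_Ioo_iff, limsup_mem_Ioo_iff]
  refine and_congr (not_congr ⟨fun h c hc => ?_, fun h c hc => ?_⟩)
    ⟨fun ⟨c, hc, h⟩ => ⟨A * c, by positivity, hfg c hc h⟩,
      fun ⟨c, hc, h⟩ => ⟨B * c, by positivity, hgf c hc h⟩⟩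
  · simpa [mul_div_cancel₀ _ hA.ne'] using hfg (c / A) (by positivity) (h _ (by positivity))
  · simpa [mul_div_cancel₀ _ hB.ne'] using hgf (c / B) (by positivity) (h _ (by positivity))

/-- The exponentially weighted integral `∫_0^t e^{−2(t−s)} σ(s)² ds`. -/
noncomputable def expVariance (σ : ℝ → ℝ) (t : ℝ) : ℝ :=
  ∫ s in (0 : ℝ)..t, exp (-2 * (t - s)) * (σ s) ^ 2

theorem expVariance_nonneg (σ : ℝ → ℝ) {t : ℝ} (ht : 0 ≤ t) : 0 ≤ expVariance σ t :=
  intervalIntegral.integral_nonneg ht fun _ _ => by positivity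

theorem intervalIntegrable_of_continuousOn_Ici {f : ℝ → ℝ} (hf : ContinuousOn f (Set.Ici 0))
    {a b : ℝ} (ha : 0 ≤ a) (hb : 0 ≤ b) : IntervalIntegrable f MeasureTheory.volume a b :=
  (hf.mono fun _ hx => (le_min ha hb).trans hx.1).intervalIntegrable

section

variable {σ : ℝ → ℝ}

theorem intervalIntegrable_exp_mul_sq (hσ : ContinuousOn σ (Set.Ici 0)) (t : ℝ) {a b : ℝ}
    (ha : 0 ≤ a) (hb : 0 ≤ b) :
    IntervalIntegrable (fun s => exp (-2 * (t - s)) * (σ s) ^ 2) MeasureTheory.volume a b :=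
  intervalIntegrable_of_continuousOn_Ici
    ((by fun_prop : Continuous fun s => exp (-2 * (t - s))).continuousOn.mul (hσ.pow 2)) ha hb

theorem expVariance_eq_add (hσ : ContinuousOn σ (Set.Ici 0)) {s t : ℝ} (hs : 0 ≤ s)
    (hst : s ≤ t) :
    expVariance σ t = exp (-2 * (t - s)) * expVariance σ s +
      ∫ u in s..t, exp (-2 * (t - u)) * (σ u) ^ 2 := by
  rw [expVariance, expVariance, ← intervalIntegral.integral_const_mul,
    ← intervalIntegral.integral_add_adjacent_intervals
      (intervalIntegrable_exp_mul_sq hσ t le_rfl hs)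
      (intervalIntegrable_exp_mul_sq hσ t hs (hs.trans hst))]
  congr 2
  funext u
  rw [← mul_assoc, ← exp_add]
  ring_nf

theorem expVariance_ge (hσ : ContinuousOn σ (Set.Ici 0)) {s t : ℝ} (hs : 0 ≤ s) (hst : s ≤ t) :
    exp (-2 * (t - s)) * expVariance σ s ≤ expVariance σ t := by
  rw [expVariance_eq_add hσ hs hst]
  exact le_add_of_nonneg_right
    (intervalIntegral.integral_nonneg hst fun _ _ => by positivity)

theorem expVariance_le_add (hσ : ContinuousOn σ (Set.Ici 0)) {s t : ℝ} (hs : 0 ≤ s)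
    (hst : s ≤ t) :
    expVariance σ t ≤ exp (-2 * (t - s)) * expVariance σ s + ∫ u in s..t, (σ u) ^ 2 := by
  rw [expVariance_eq_add hσ hs hst]
  gcongr
  refine intervalIntegral.integral_mono_on hst
    (intervalIntegrable_exp_mul_sq hσ t hs (hs.trans hst))
    (intervalIntegrable_of_continuousOn_Ici (hσ.pow 2) hs (hs.trans hst)) fun u hu => ?_
  exact mul_le_of_le_one_left (sq_nonneg _) (exp_le_one_iff.2 (by linarith [hu.2]))

theorem exp_mul_integral_sq_le (hσ : ContinuousOn σ (Set.Ici 0)) {s t : ℝ} (hs : 0 ≤ s)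
    (hst : s ≤ t) :
    exp (-2 * (t - s)) * ∫ u in s..t, (σ u) ^ 2 ≤ expVariance σ t := by
  rw [expVariance_eq_add hσ hs hst, ← intervalIntegral.integral_const_mul]
  refine le_add_of_nonneg_of_le (mul_nonneg (exp_pos _).le (expVariance_nonneg σ hs)) ?_
  refine intervalIntegral.integral_mono_on hst
    ((intervalIntegrable_of_continuousOn_Ici (hσ.pow 2) hs (hs.trans hst)).const_mul _)
    (intervalIntegrable_exp_mul_sq hσ t hs (hs.trans hst)) fun u hu => ?_
  have := hu.1
  gcongr exp ?_ * _
  linarith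

theorem sq_theta (σ : ℝ → ℝ) (n : ℕ) :
    theta σ n ^ 2 = ∫ s in (n : ℝ)..((n : ℝ) + 1), (σ s) ^ 2 :=
  sq_sqrt (intervalIntegral.integral_nonneg (by linarith) fun _ _ => sq_nonneg _)

theorem Sig2_le_Sig2_ceil (hσ : ContinuousOn σ (Set.Ici 0)) {t : ℝ} (ht : 1 ≤ t) :
    Sig2 σ t ≤ exp 2 * Sig2 σ ⌈t⌉₊ := by
  have h1 : t ≤ ⌈t⌉₊ := Nat.le_ceil t
  have h2 : (⌈t⌉₊ : ℝ) < t + 1 := Nat.ceil_lt_add_one (by linarith)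
  have hV := expVariance_ge hσ (by linarith) h1
  have hV0 := expVariance_nonneg σ (by linarith : 0 ≤ t)
  have hle : expVariance σ t ≤ exp 2 * expVariance σ ⌈t⌉₊ :=
    calc expVariance σ t
        ≤ exp (2 + -2 * (⌈t⌉₊ - t)) * expVariance σ t :=
          le_mul_of_one_le_left hV0 (one_le_exp (by linarith))
      _ = exp 2 * (exp (-2 * (⌈t⌉₊ - t)) * expVariance σ t) := by rw [exp_add, mul_assoc]
      _ ≤ exp 2 * expVariance σ ⌈t⌉₊ := by gcongr
  calc expVariance σ t * log t ≤ (exp 2 * expVariance σ ⌈t⌉₊) * log ⌈t⌉₊ :=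
        mul_le_mul hle (log_le_log (by linarith) h1) (log_nonneg ht) (hV0.trans hle)
    _ = exp 2 * Sig2 σ ⌈t⌉₊ := mul_assoc _ _ _

theorem sq_theta_mul_log_le (hσ : ContinuousOn σ (Set.Ici 0)) {n : ℕ} (hn : 1 ≤ n) :
    theta σ n ^ 2 * log n ≤ exp 2 * Sig2 σ (n + 1 : ℕ) := by
  have hn' : (1 : ℝ) ≤ n := by exact_mod_cast hn
  have h := exp_mul_integral_sq_le hσ (by linarith : (0 : ℝ) ≤ n) (by linarith : (n : ℝ) ≤ n + 1)
  rw [← sq_theta, add_sub_cancel_left, mul_one] at h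
  have hle : theta σ n ^ 2 ≤ exp 2 * expVariance σ (n + 1) := by
    calc theta σ n ^ 2 = exp 2 * (exp (-2) * theta σ n ^ 2) := by
          rw [← mul_assoc, ← exp_add]; simp
      _ ≤ _ := by gcongr
  push_cast
  calc theta σ n ^ 2 * log n ≤ (exp 2 * expVariance σ (n + 1)) * log (n + 1) :=
        mul_le_mul hle (log_le_log (by linarith) (by linarith)) (log_nonneg hn')
          ((sq_nonneg _).trans hle)
    _ = exp 2 * Sig2 σ (n + 1) := mul_assoc _ _ _

theorem Sig2_succ_le (hσ : ContinuousOn σ (Set.Ici 0)) {n : ℕ} (hn : 2 ≤ n) :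
    Sig2 σ (n + 1 : ℕ) ≤ 1 / 2 * Sig2 σ n + 2 * (theta σ n ^ 2 * log n) := by
  have hn' : (2 : ℝ) ≤ n := by exact_mod_cast hn
  have h := expVariance_le_add hσ (by linarith : (0 : ℝ) ≤ n) (by linarith : (n : ℝ) ≤ n + 1)
  rw [← sq_theta, add_sub_cancel_left, mul_one] at h
  have hV0 := expVariance_nonneg σ (by linarith : (0 : ℝ) ≤ n)
  have hlog0 : 0 ≤ log n := log_nonneg (by linarith)
  have hlog : log (n + 1 : ℝ) ≤ 2 * log n := by
    calc log (n + 1 : ℝ) ≤ log ((n : ℝ) ^ 2) := log_le_log (by linarith) (by nlinarith)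
      _ = 2 * log n := by rw [log_pow]; norm_num
  have hexp : exp (-2) ≤ 1 / 4 := by
    rw [exp_neg, one_div]
    refine inv_anti₀ (by norm_num) ?_
    have h1 := add_one_le_exp (1 : ℝ)
    calc (4 : ℝ) ≤ exp 1 * exp 1 := by nlinarith
      _ = exp 2 := by rw [← exp_add]; norm_num
  have hle : expVariance σ (n + 1) ≤ 1 / 4 * expVariance σ n + theta σ n ^ 2 :=
    h.trans (by gcongr)
  push_cast
  calc expVariance σ (n + 1) * log (n + 1)
      ≤ (1 / 4 * expVariance σ n + theta σ n ^ 2) * (2 * log n) :=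
        mul_le_mul hle hlog (log_nonneg (by linarith)) (by positivity)
    _ = 1 / 2 * (expVariance σ n * log n) + 2 * (theta σ n ^ 2 * log n) := by ring

end

theorem eventually_le_of_succ_le_half_add {y : ℕ → ℝ} {d e : ℝ} (hde : 2 * d < e)
    (h : ∀ᶠ n in atTop, y (n + 1) ≤ 1 / 2 * y n + d) : ∀ᶠ n in atTop, y n ≤ e := by
  obtain ⟨N, hN⟩ := eventually_atTop.1 h
  have hb : ∀ k : ℕ, y (k + N) ≤ 2 * d + (1 / 2) ^ k * (y N - 2 * d) := by
    intro k
    induction k with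
    | zero => simp
    | succ k ih =>
      have := hN (k + N) (by omega)
      rw [show k + 1 + N = k + N + 1 by ring, pow_succ]
      linarith
  have hlim : Tendsto (fun k : ℕ => 2 * d + (1 / 2 : ℝ) ^ k * (y N - 2 * d)) atTop (𝓝 (2 * d)) := by
    simpa using ((tendsto_pow_atTop_nhds_zero_of_lt_one (by norm_num : (0 : ℝ) ≤ 1 / 2)
      (by norm_num)).mul_const (y N - 2 * d)).const_add (2 * d)
  rw [← map_add_atTop_eq_nat N, eventually_map]
  filter_upwards [hlim.eventually_lt_const hde] with k hk using (hb k).trans hk.le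

theorem summable_mul_exp_neg_sq_div {θ : ℕ → ℝ} (hθ : ∀ n, 0 ≤ θ n) {c ε : ℝ} (hc : 0 < c)
    (h : ∀ᶠ n : ℕ in atTop, θ n ^ 2 * log n ≤ c) (hε : 2 * sqrt c < ε) :
    Summable fun n => θ n * exp (-(ε ^ 2) / (2 * θ n ^ 2)) := by
  have hsum : Summable fun n : ℕ => sqrt c * (1 / (n : ℝ) ^ 2) :=
    (Real.summable_one_div_nat_pow.2 one_lt_two).mul_left _
  have hεc : 4 * c ≤ ε ^ 2 := by
    nlinarith [sq_sqrt hc.le, sqrt_nonneg c]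
  refine summable_of_isBigO_nat hsum (Asymptotics.IsBigO.of_bound 1 ?_)
  filter_upwards [h, eventually_ge_atTop 3] with n hn hn3
  have hn3' : (3 : ℝ) ≤ n := by exact_mod_cast hn3
  have hlog : 1 ≤ log n := by
    rw [le_log_iff_exp_le (by linarith)]
    linarith [exp_one_lt_d9]
  rw [one_mul, norm_of_nonneg (mul_nonneg (hθ n) (exp_pos _).le), norm_of_nonneg (by positivity)]
  rcases (hθ n).eq_or_lt with h0 | hpos
  · rw [← h0, zero_mul]
    positivity
  have hsq : 0 < θ n ^ 2 := by positivity
  refine mul_le_mul (le_sqrt_of_sq_le (by nlinarith)) ?_ (exp_pos _).le (sqrt_nonneg _)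
  calc exp (-(ε ^ 2) / (2 * θ n ^ 2)) ≤ exp (-(2 * log n)) := by
        gcongr
        rw [div_le_iff₀ (by positivity)]
        nlinarith
    _ = 1 / (n : ℝ) ^ 2 := by
        rw [exp_neg, two_mul, exp_add, exp_log (by linarith), one_div, sq]

/-- The statements `limsup_{t→∞} Σ²(t) ∈ (0,∞)`, `limsup_{n→∞} Σ²(n) ∈ (0,∞)` and
`limsup_{n→∞} θ(n)²·log n ∈ (0,∞)` are equivalent; and each implies that there is an
`ε' > 0` with `S'(ε) < ∞` for all `ε > ε'`. (Limits superior are taken in `EReal`.) -/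
theorem stmt_6 (σ : ℝ → ℝ) (hσ : ContinuousOn σ (Set.Ici 0)) :
    ((0 < Filter.limsup (fun t : ℝ => ((Sig2 σ t : ℝ) : EReal)) Filter.atTop ∧
        Filter.limsup (fun t : ℝ => ((Sig2 σ t : ℝ) : EReal)) Filter.atTop < ⊤) ↔
      (0 < Filter.limsup (fun n : ℕ => ((Sig2 σ n : ℝ) : EReal)) Filter.atTop ∧
        Filter.limsup (fun n : ℕ => ((Sig2 σ n : ℝ) : EReal)) Filter.atTop < ⊤)) ∧
    ((0 < Filter.limsup (fun n : ℕ => ((Sig2 σ n : ℝ) : EReal)) Filter.atTop ∧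
        Filter.limsup (fun n : ℕ => ((Sig2 σ n : ℝ) : EReal)) Filter.atTop < ⊤) ↔
      (0 < Filter.limsup (fun n : ℕ => (((theta σ n) ^ 2 * Real.log n : ℝ) : EReal))
            Filter.atTop ∧
        Filter.limsup (fun n : ℕ => (((theta σ n) ^ 2 * Real.log n : ℝ) : EReal))
            Filter.atTop < ⊤)) ∧
    ((0 < Filter.limsup (fun t : ℝ => ((Sig2 σ t : ℝ) : EReal)) Filter.atTop ∧
        Filter.limsup (fun t : ℝ => ((Sig2 σ t : ℝ) : EReal)) Filter.atTop < ⊤) →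
      ∃ ε' : ℝ, 0 < ε' ∧ ∀ ε : ℝ, ε' < ε → Summable (fun n : ℕ =>
        theta σ n * Real.exp (-(ε ^ 2) / (2 * (theta σ n) ^ 2)))) := by
  have hreal_nat : ∀ c : ℝ, 0 < c → (∀ᶠ t : ℝ in atTop, Sig2 σ t ≤ c) →
      ∀ᶠ n : ℕ in atTop, Sig2 σ n ≤ 1 * c := fun c _ h => by
    simpa using tendsto_natCast_atTop_atTop.eventually h
  have hnat_theta : ∀ c : ℝ, 0 < c → (∀ᶠ n : ℕ in atTop, Sig2 σ n ≤ c) →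
      ∀ᶠ n : ℕ in atTop, theta σ n ^ 2 * log n ≤ exp 2 * c := fun c _ h => by
    filter_upwards [(tendsto_add_atTop_nat 1).eventually h, eventually_ge_atTop 1] with n hn h1
    exact (sq_theta_mul_log_le hσ h1).trans (by gcongr)
  refine ⟨limsup_mem_Ioo_congr one_pos (exp_pos 2) hreal_nat fun c _ h => ?_,
    limsup_mem_Ioo_congr (B := 5) (exp_pos 2) (by norm_num) hnat_theta fun c hc h => ?_,
    fun h => ?_⟩
  · filter_upwards [(tendsto_nat_ceil_atTop (α := ℝ)).eventually h, eventually_ge_atTop 1]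
      with t ht h1
    exact (Sig2_le_Sig2_ceil hσ h1).trans (by gcongr)
  · refine eventually_le_of_succ_le_half_add (y := fun n : ℕ => Sig2 σ n) (d := 2 * c)
      (by linarith) ?_
    filter_upwards [h, eventually_ge_atTop 2] with n hn h2
    exact (Sig2_succ_le hσ h2).trans (by gcongr)
  · obtain ⟨-, c, hc, h⟩ := limsup_mem_Ioo_iff.1 h
    refine ⟨2 * sqrt (exp 2 * (1 * c)), by positivity, fun ε hε => ?_⟩
    exact summable_mul_exp_neg_sq_div (fun n => sqrt_nonneg _) (by positivity)
      (hnat_theta _ (by positivity) (hreal_nat c hc h)) hε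
end

section
/- Let p̄ > 0, let p : [0,∞) → ℝ be continuous with limsup_{t→∞} |p(t)| ≤ p̄, and let z : [0,∞) → ℝ be a differentiable function satisfying z'(t) = −f(z(t) + p(t)) + p(t) for all t > 0. Then limsup_{t→∞} |z(t)| ≤ p̄ + max(f⁺(p̄), −f⁻(−p̄)), and the function x(t) = z(t) + p(t) satisfies limsup_{t→∞} |x(t)| ≤ x̄(f,p̄) = 2p̄ + max(f⁺(p̄), −f⁻(−p̄)). -/
/-- `f⁺(x) = sup {z > 0 : f(z) = x}`. -/
noncomputable def fplus (f : ℝ → ℝ) (x : ℝ) : ℝ := sSup {z : ℝ | 0 < z ∧ f z = x}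

/-- `f⁻(x) = inf {z < 0 : f(z) = x}`. -/
noncomputable def fminus (f : ℝ → ℝ) (x : ℝ) : ℝ := sInf {z : ℝ | z < 0 ∧ f z = x}

/-- `x̄(f,y) = 2y + max(f⁺(y), −f⁻(−y))`. -/
noncomputable def xbar (f : ℝ → ℝ) (y : ℝ) : ℝ :=
  2 * y + max (fplus f y) (-(fminus f (-y)))

open Filter Set

theorem fminus_neg_eq (f : ℝ → ℝ) (y : ℝ) :
    -(fminus f (-y)) = fplus (fun x => -(f (-x))) y := by
  unfold fminus fplus
  rw [Real.sInf_def, neg_neg]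
  congr 1
  ext x
  simp [neg_eq_iff_eq_neg]

theorem fplus_nonneg (f : ℝ → ℝ) (y : ℝ) : 0 ≤ fplus f y :=
  Real.sSup_nonneg fun _ hx => hx.1.le

theorem lt_apply_of_fplus_lt {f : ℝ → ℝ} (hc : Continuous f) (htop : Tendsto f atTop atTop)
    {y u : ℝ} (hu : fplus f y < u) : y < f u := by
  by_contra! hle
  obtain ⟨R, hR⟩ := eventually_atTop.1 (htop.eventually_gt_atTop y)
  obtain ⟨v, hv, hfv⟩ := intermediate_value_Icc (le_max_left u R) hc.continuousOn
    ⟨hle, (hR _ (le_max_right u R)).le⟩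
  have hbdd : BddAbove {z : ℝ | 0 < z ∧ f z = y} := by
    refine ⟨R, fun w hw => ?_⟩
    by_contra! hRw
    exact (hR w hRw.le).ne' hw.2
  have hvle : v ≤ fplus f y :=
    le_csSup hbdd ⟨(fplus_nonneg f y).trans_lt (hu.trans_le hv.1), hfv⟩
  linarith [hv.1]

theorem exists_pos_add_le_of_lt_of_tendsto_atTop {f : ℝ → ℝ} (hc : Continuous f)
    (htop : Tendsto f atTop atTop) {y a : ℝ} (h : ∀ u, a ≤ u → y < f u) :
    ∃ δ > 0, ∀ u, a ≤ u → y + δ ≤ f u := by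
  obtain ⟨R, hR⟩ := eventually_atTop.1 (htop.eventually_ge_atTop (y + 1))
  obtain ⟨m, hm, hmin⟩ := (isCompact_Icc (a := a) (b := max a R)).exists_isMinOn
    ⟨a, left_mem_Icc.2 (le_max_left a R)⟩ hc.continuousOn
  refine ⟨min 1 (f m - y), lt_min one_pos (sub_pos.2 (h m hm.1)), fun u hu => ?_⟩
  rcases le_total u (max a R) with hle | hge
  · have := isMinOn_iff.1 hmin u ⟨hu, hle⟩
    linarith [min_le_right 1 (f m - y)]
  · linarith [hR u ((le_max_right a R).trans hge), min_le_left 1 (f m - y)]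

/-- A function that decreases at a uniform rate while it is at least `B` is eventually at
most `B`. -/
theorem eventually_le_of_deriv_le_neg {z z' : ℝ → ℝ} {T B δ : ℝ} (hδ : 0 < δ)
    (hz : ∀ t, T ≤ t → HasDerivAt z (z' t) t)
    (hdec : ∀ t, T ≤ t → B ≤ z t → z' t ≤ -δ) :
    ∀ᶠ t in atTop, z t ≤ B := by
  set C := max (z T) B
  have hCB : B ≤ C := le_max_right _ _
  set S := T + 2 * (C - B) / δ with hS
  have hTS : T ≤ S := le_add_of_nonneg_right (by have := sub_nonneg.2 hCB; positivity)
  have hSB : C - δ / 2 * (S - T) = B := by rw [hS]; field_simp; ring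
  have hzS : z S ≤ B := by
    have hbound : ∀ t, HasDerivAt (fun t => C - δ / 2 * (t - T)) (-(δ / 2)) t := fun t => by
      simpa using (((hasDerivAt_id t).sub_const T).const_mul (δ / 2)).const_sub C
    have := image_le_of_deriv_right_lt_deriv_boundary (f := z) (f' := z') (a := T) (b := S)
      (fun t ht => (hz t ht.1).continuousAt.continuousWithinAt)
      (fun t ht => (hz t ht.1).hasDerivWithinAt)
      (by simp [C]) hbound
      (fun t ht heq => by
        have hle : δ / 2 * (t - T) ≤ δ / 2 * (S - T) := by gcongr; exact ht.2.le
        have := hdec t ht.1 (by rw [heq]; linarith)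
        linarith) (right_mem_Icc.2 hTS)
    exact this.trans_eq hSB
  filter_upwards [eventually_ge_atTop S] with t ht
  exact image_le_of_deriv_right_lt_deriv_boundary (f := z) (f' := z') (a := S) (b := t)
    (B := fun _ => B) (B' := fun _ => 0)
    (fun s hs => (hz s (hTS.trans hs.1)).continuousAt.continuousWithinAt)
    (fun s hs => (hz s (hTS.trans hs.1)).hasDerivWithinAt)
    hzS (fun s => hasDerivAt_const s B)
    (fun s hs heq => by linarith [hdec s (hTS.trans hs.1) heq.ge]) (right_mem_Icc.2 ht)

theorem limsup_coe_le_iff_forall_pos_eventually_le {g : ℝ → ℝ} {c : ℝ} :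
    limsup (fun t : ℝ => ((g t : ℝ) : EReal)) atTop ≤ (c : EReal) ↔
      ∀ ε > 0, ∀ᶠ t in atTop, g t ≤ c + ε := by
  rw [limsup_le_iff]
  constructor
  · intro h ε hε
    filter_upwards [h ((c + ε : ℝ) : EReal) (EReal.coe_lt_coe_iff.2 (by linarith))] with t ht
    exact (EReal.coe_lt_coe_iff.1 ht).le
  · intro h b hb
    obtain ⟨d, hcd, hdb⟩ := EReal.lt_iff_exists_real_btwn.1 hb
    filter_upwards [h (d - c) (sub_pos.2 (EReal.coe_lt_coe_iff.1 hcd))] with t ht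
    exact (EReal.coe_le_coe_iff.2 (by linarith)).trans_lt hdb

theorem eventually_le_add_fplus {f p z : ℝ → ℝ} {y : ℝ} (hc : Continuous f)
    (htop : Tendsto f atTop atTop) (hp : ∀ ε > 0, ∀ᶠ t in atTop, |p t| ≤ y + ε)
    (hz : ∀ t : ℝ, 0 < t → HasDerivAt z (-(f (z t + p t)) + p t) t) {ε : ℝ} (hε : 0 < ε) :
    ∀ᶠ t in atTop, z t ≤ y + fplus f y + ε := by
  obtain ⟨δ, hδ, hfδ⟩ := exists_pos_add_le_of_lt_of_tendsto_atTop hc htop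
    (y := y) (a := fplus f y + ε / 2)
    fun u hu => lt_apply_of_fplus_lt hc htop (by linarith)
  obtain ⟨T, hT⟩ := eventually_atTop.1
    (((hp (δ / 2) (by positivity)).and (hp (ε / 2) (by positivity))).and (eventually_gt_atTop 0))
  refine eventually_le_of_deriv_le_neg (half_pos hδ) (fun t ht => hz t (hT t ht).2)
    fun t ht hB => ?_
  obtain ⟨⟨hpδ, hpε⟩, -⟩ := hT t ht
  have := hfδ (z t + p t) (by linarith [neg_abs_le (p t)])
  linarith [le_abs_self (p t)]

/-- If `limsup_{t→∞} |p(t)| ≤ p̄` and `z' = −f(z + p) + p` on `(0,∞)`, then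
`limsup_{t→∞} |z(t)| ≤ p̄ + max(f⁺(p̄), −f⁻(−p̄))` and `x = z + p` satisfies
`limsup_{t→∞} |x(t)| ≤ x̄(f,p̄)`. (Limits superior are taken in `EReal`.) -/
theorem stmt_12 (f : ℝ → ℝ) (hc : Continuous f) (h0 : f 0 = 0)
    (hs : ∀ x : ℝ, x ≠ 0 → 0 < x * f x)
    (htop : Filter.Tendsto f Filter.atTop Filter.atTop)
    (hbot : Filter.Tendsto f Filter.atBot Filter.atBot)
    (pbar : ℝ) (hpbar : 0 < pbar)
    (p : ℝ → ℝ) (hp : ContinuousOn p (Set.Ici 0))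
    (hplim : Filter.limsup (fun t : ℝ => ((|p t| : ℝ) : EReal)) Filter.atTop ≤
      ((pbar : ℝ) : EReal))
    (z : ℝ → ℝ) (hzc : ContinuousOn z (Set.Ici 0))
    (hz : ∀ t : ℝ, 0 < t → HasDerivAt z (-(f (z t + p t)) + p t) t) :
    Filter.limsup (fun t : ℝ => ((|z t| : ℝ) : EReal)) Filter.atTop ≤
      ((pbar + max (fplus f pbar) (-(fminus f (-pbar))) : ℝ) : EReal) ∧
    Filter.limsup (fun t : ℝ => ((|z t + p t| : ℝ) : EReal)) Filter.atTop ≤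
      ((xbar f pbar : ℝ) : EReal) := by
  have hp' := limsup_coe_le_iff_forall_pos_eventually_le.1 hplim
  have hzlim : ∀ ε > 0, ∀ᶠ t in atTop,
      |z t| ≤ pbar + max (fplus f pbar) (-(fminus f (-pbar))) + ε := by
    intro ε hε
    have hneg := eventually_le_add_fplus (f := fun x => -(f (-x))) (p := fun t => -(p t))
      (z := fun t => -(z t)) (y := pbar) (by fun_prop)
      (tendsto_neg_atBot_atTop.comp (hbot.comp tendsto_neg_atTop_atBot))
      (by simpa only [abs_neg] using hp')
      (fun t ht => by
        refine (hz t ht).fun_neg.congr_deriv ?_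
        rw [neg_add, neg_add (-(z t)), neg_neg (z t), neg_neg (p t)]) hε
    rw [← fminus_neg_eq] at hneg
    filter_upwards [eventually_le_add_fplus hc htop hp' hz hε, hneg] with t h1 h2
    rw [abs_le']
    exact ⟨h1.trans (by gcongr; exact le_max_left _ _),
      h2.trans (by gcongr; exact le_max_right _ _)⟩
  refine ⟨limsup_coe_le_iff_forall_pos_eventually_le.2 hzlim,
    limsup_coe_le_iff_forall_pos_eventually_le.2 fun ε hε => ?_⟩
  filter_upwards [hzlim (ε / 2) (half_pos hε), hp' (ε / 2) (half_pos hε)] with t h1 h2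
  unfold xbar
  linarith [abs_add_le (z t) (p t)]
end

section
/- Let Y : [0,∞) → ℝ be continuous with Y(t) → 0 as t → ∞, and let z : [0,∞) → ℝ be a differentiable function satisfying z'(t) = −f(z(t) + Y(t)) + Y(t) for all t > 0. If liminf_{t→∞} |z(t)| = 0, then z(t) → 0 as t → ∞ (and hence also z(t) + Y(t) → 0 as t → ∞). -/
/-- A trajectory whose velocity is negative whenever it meets the level `c` stays below `c`. -/
theorem le_of_hasDerivAt_neg_of_eq {z v : ℝ → ℝ} {a c : ℝ}
    (hz : ∀ t, a ≤ t → HasDerivAt z (v t) t) (ha : z a ≤ c)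
    (hv : ∀ t, a ≤ t → z t = c → v t < 0) {t : ℝ} (ht : a ≤ t) : z t ≤ c :=
  image_le_of_deriv_right_lt_deriv_boundary (B := fun _ => c) (B' := fun _ => 0)
    (fun s hs => (hz s hs.1).continuousAt.continuousWithinAt)
    (fun s hs => (hz s hs.1).hasDerivWithinAt) ha (fun s => hasDerivAt_const s c)
    (fun s hs => hv s hs.1) (Set.right_mem_Icc.2 ht)

/-- If the lower limit of `|z|` vanishes, then `|z|` is frequently below every positive level. -/
theorem frequently_abs_lt_of_liminf_eq_zero {α : Type*} {l : Filter α} {z : α → ℝ}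
    (h : Filter.liminf (fun t => ((|z t| : ℝ) : EReal)) l = 0) {ε : ℝ} (hε : 0 < ε) :
    ∃ᶠ t in l, |z t| < ε := by
  intro hge
  have hle : (ε : EReal) ≤ Filter.liminf (fun t => ((|z t| : ℝ) : EReal)) l :=
    Filter.le_liminf_of_le (by isBoundedDefault)
      (hge.mono fun t ht => EReal.coe_le_coe_iff.2 (not_lt.1 ht))
  rw [h] at hle
  exact hε.not_ge (EReal.coe_nonpos.1 hle)

/-- If `Y(t) → 0`, `z' = −f(z + Y) + Y` on `(0,∞)` and `liminf_{t→∞} |z(t)| = 0`,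
then `z(t) → 0` and hence `z(t) + Y(t) → 0` as `t → ∞`. -/
theorem stmt_13 (f : ℝ → ℝ) (hc : Continuous f) (h0 : f 0 = 0)
    (hs : ∀ x : ℝ, x ≠ 0 → 0 < x * f x)
    (Y : ℝ → ℝ) (hYc : ContinuousOn Y (Set.Ici 0))
    (hY : Filter.Tendsto Y Filter.atTop (nhds 0))
    (z : ℝ → ℝ) (hzc : ContinuousOn z (Set.Ici 0))
    (hz : ∀ t : ℝ, 0 < t → HasDerivAt z (-(f (z t + Y t)) + Y t) t)
    (hliminf : Filter.liminf (fun t : ℝ => ((|z t| : ℝ) : EReal)) Filter.atTop = 0) :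
    Filter.Tendsto z Filter.atTop (nhds 0) ∧
    Filter.Tendsto (fun t => z t + Y t) Filter.atTop (nhds 0) := by
  have hlim (c : ℝ) : Filter.Tendsto (fun t => -(f (c + Y t)) + Y t) Filter.atTop
      (nhds (-(f c))) := by
    have hcont : Continuous fun y => -(f (c + y)) + y := by fun_prop
    simpa [Function.comp_def] using (hcont.tendsto 0).comp hY
  have hzlim : Filter.Tendsto z Filter.atTop (nhds 0) := by
    refine Metric.tendsto_nhds.2 fun ε hε => ?_
    obtain ⟨c, hcpos, hcε⟩ := exists_between hε
    have hup : -(f c) < 0 := neg_neg_of_pos (pos_of_mul_pos_right (hs c hcpos.ne') hcpos.le)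
    have hlow : 0 < -(f (-c)) := by
      have := hs (-c) (neg_ne_zero.2 hcpos.ne')
      exact pos_of_mul_pos_right (by linarith : 0 < c * -(f (-c))) hcpos.le
    obtain ⟨T, hT⟩ := Filter.eventually_atTop.1 (((hlim c).eventually_lt_const hup).and
      ((hlim (-c)).eventually_const_lt hlow))
    obtain ⟨a, hca, haT⟩ := ((frequently_abs_lt_of_liminf_eq_zero hliminf hcpos).and_eventually
      (Filter.eventually_ge_atTop (max T 1))).exists
    have hTa : T ≤ a := (le_max_left T 1).trans haT
    have ha : 0 < a := one_pos.trans_le ((le_max_right T 1).trans haT)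
    have hza := abs_lt.1 hca
    filter_upwards [Filter.eventually_ge_atTop a] with t ht
    have h1 : z t ≤ c := le_of_hasDerivAt_neg_of_eq
      (fun s hs => hz s (ha.trans_le hs)) hza.2.le
      (fun s hs hzs => by rw [hzs]; exact (hT s (hTa.trans hs)).1) ht
    have h2 : (-z) t ≤ c := le_of_hasDerivAt_neg_of_eq
      (fun s hs => (hz s (ha.trans_le hs)).neg) (neg_le.1 hza.1.le)
      (fun s hs hzs => by
        rw [show z s = -c from neg_eq_iff_eq_neg.1 hzs]
        exact neg_neg_of_pos (hT s (hTa.trans hs)).2) ht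
    rw [Real.dist_0_eq_abs]
    exact (abs_le'.2 ⟨h1, h2⟩).trans_lt hcε
  exact ⟨hzlim, by simpa using hzlim.add hY⟩
end

section
/- If f₁ and f₂ are two functions each of which is continuous, vanishes at 0, satisfies x·f(x) > 0 for all x ≠ 0, and tends to +∞ at +∞ and to −∞ at −∞, and if |f₂(x)| ≥ |f₁(x)| for all x ∈ ℝ, then x̄(f₁,y) ≥ x̄(f₂,y) for every y > 0. -/
theorem neg_fminus_neg (f : ℝ → ℝ) (y : ℝ) :
    -(fminus f (-y)) = fplus (fun x => -f (-x)) y := by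
  rw [fminus, fplus, Real.sInf_def, neg_neg]
  congr 1
  ext z
  simp only [Set.mem_neg, Set.mem_ofPred_eq, neg_lt_zero, neg_eq_iff_eq_neg]

theorem bddAbove_setOf_pos_eq {f : ℝ → ℝ} (hf : Filter.Tendsto f Filter.atTop Filter.atTop)
    (y : ℝ) : BddAbove {z : ℝ | 0 < z ∧ f z = y} := by
  obtain ⟨b, hb⟩ := Filter.eventually_atTop.1 (hf.eventually_gt_atTop y)
  refine ⟨b, fun z hz => ?_⟩
  by_contra! h
  exact (hb z h.le).ne' hz.2

theorem fplus_le_fplus {f g : ℝ → ℝ} (hc : Continuous f)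
    (htop : Filter.Tendsto f Filter.atTop Filter.atTop)
    (hle : ∀ z, 0 < z → f z ≤ g z) (y : ℝ) : fplus g y ≤ fplus f y := by
  refine Real.sSup_le (fun z ⟨hz, hgz⟩ => ?_) (Real.sSup_nonneg fun z hz => hz.1.le)
  obtain ⟨b, hyb, hzb⟩ :=
    ((htop.eventually_ge_atTop y).and (Filter.eventually_ge_atTop z)).exists
  obtain ⟨w, hw, hfw⟩ :=
    intermediate_value_Icc hzb hc.continuousOn ⟨(hle z hz).trans_eq hgz, hyb⟩
  exact hw.1.trans (le_csSup (bddAbove_setOf_pos_eq htop y) ⟨hz.trans_le hw.1, hfw⟩)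

/-- If `f₁, f₂` are continuous, vanish at `0`, satisfy `x·f(x) > 0` for `x ≠ 0`, tend to
`±∞` at `±∞`, and `|f₂| ≥ |f₁|` pointwise, then `x̄(f₁,y) ≥ x̄(f₂,y)` for every `y > 0`. -/
theorem stmt_15 (f₁ f₂ : ℝ → ℝ)
    (h₁c : Continuous f₁) (h₁0 : f₁ 0 = 0) (h₁s : ∀ x : ℝ, x ≠ 0 → 0 < x * f₁ x)
    (h₁top : Filter.Tendsto f₁ Filter.atTop Filter.atTop)
    (h₁bot : Filter.Tendsto f₁ Filter.atBot Filter.atBot)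
    (h₂c : Continuous f₂) (h₂0 : f₂ 0 = 0) (h₂s : ∀ x : ℝ, x ≠ 0 → 0 < x * f₂ x)
    (h₂top : Filter.Tendsto f₂ Filter.atTop Filter.atTop)
    (h₂bot : Filter.Tendsto f₂ Filter.atBot Filter.atBot)
    (hdom : ∀ x : ℝ, |f₁ x| ≤ |f₂ x|) :
    ∀ y : ℝ, 0 < y → xbar f₂ y ≤ xbar f₁ y := by
  intro y _
  rw [xbar, xbar, neg_fminus_neg, neg_fminus_neg]
  refine add_le_add_right (max_le_max (fplus_le_fplus h₁c h₁top (fun z hz => ?_) y)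
    (fplus_le_fplus (by fun_prop) ?_ (fun z hz => ?_) y)) _
  · have h₂ := pos_of_mul_pos_right (h₂s z hz.ne') hz.le
    exact (le_abs_self _).trans ((hdom z).trans_eq (abs_of_pos h₂))
  · exact Filter.tendsto_neg_atBot_atTop.comp (h₁bot.comp Filter.tendsto_neg_atTop_atBot)
  · have h₂ : f₂ (-z) < 0 := by
      have := h₂s (-z) (neg_ne_zero.2 hz.ne')
      exact neg_of_mul_pos_right this (neg_nonpos.2 hz.le)
    exact (neg_le_abs _).trans ((hdom (-z)).trans_eq (abs_of_neg h₂))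
end

section
/- Let f : ℝ → ℝ be continuous and let x : [0,∞) → ℝ be continuous with X* := limsup_{t→∞} |x(t)| < +∞. Define y : [0,∞) → ℝ by y(t) = x(t) − x(0)·e^{−t} − ∫_0^t e^{−(t−s)}·(x(s) − f(x(s))) ds. Then limsup_{t→∞} |y(t)| ≤ 2X* + max_{|u|≤X*} |f(u)| = h_f(X*). -/
/-- `h_f(x) = 2x + max_{|y| ≤ x} |f(y)|`. -/
noncomputable def hfun (f : ℝ → ℝ) (x : ℝ) : ℝ :=
  2 * x + sSup ((fun y => |f y|) '' Set.Icc (-x) x)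

open Filter Topology Set

/-- An exponentially weighted average of a function that is eventually bounded by `G` is
eventually bounded by any `H > G`. -/
theorem eventually_abs_integral_exp_mul_le {g : ℝ → ℝ} (hg : ContinuousOn g (Ici 0))
    {G H : ℝ} (hG : ∀ᶠ t in atTop, |g t| ≤ G) (hGH : G < H) :
    ∀ᶠ t in atTop, |∫ s in (0 : ℝ)..t, Real.exp (-(t - s)) * g s| ≤ H := by
  obtain ⟨T₀, hT₀⟩ := eventually_atTop.1 hG
  set T := max T₀ 0 with hT
  have hT0 : 0 ≤ T := le_max_right _ _
  have hbound : ∀ s, T ≤ s → |g s| ≤ G := fun s hs => hT₀ s ((le_max_left _ _).trans hs)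
  have hG0 : 0 ≤ G := (abs_nonneg _).trans (hbound T le_rfl)
  set C := ∫ s in (0 : ℝ)..T, Real.exp s * g s with hC
  have hint : ∀ a b, 0 ≤ a → a ≤ b →
      IntervalIntegrable (fun s => Real.exp s * g s) MeasureTheory.volume a b := by
    intro a b ha hab
    refine ContinuousOn.intervalIntegrable_of_Icc hab ?_
    exact Real.continuous_exp.continuousOn.mul (hg.mono fun s hs => ha.trans hs.1)
  have hlim : Tendsto (fun t : ℝ => Real.exp (-t) * |C|) atTop (𝓝 0) := by
    simpa using Real.tendsto_exp_neg_atTop_nhds_zero.mul_const |C|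
  filter_upwards [eventually_ge_atTop T,
    hlim.eventually_lt_const (sub_pos.2 hGH)] with t ht hsmall
  have hfactor : ∫ s in (0 : ℝ)..t, Real.exp (-(t - s)) * g s =
      Real.exp (-t) * (C + ∫ s in T..t, Real.exp s * g s) := by
    rw [hC, intervalIntegral.integral_add_adjacent_intervals (hint 0 T le_rfl hT0)
      (hint T t hT0 ht), ← intervalIntegral.integral_const_mul]
    refine intervalIntegral.integral_congr fun s _ => ?_
    change Real.exp (-(t - s)) * g s = Real.exp (-t) * (Real.exp s * g s)
    rw [← mul_assoc, ← Real.exp_add]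
    ring_nf
  have htail : |∫ s in T..t, Real.exp s * g s| ≤ G * Real.exp t := by
    calc |∫ s in T..t, Real.exp s * g s|
        ≤ ∫ s in T..t, G * Real.exp s := by
          rw [← Real.norm_eq_abs]
          refine intervalIntegral.norm_integral_le_of_norm_le ht
            (Eventually.of_forall fun s hs => ?_)
            ((continuous_const.mul Real.continuous_exp).intervalIntegrable _ _)
          rw [Real.norm_eq_abs, abs_mul, Real.abs_exp, mul_comm]
          exact mul_le_mul_of_nonneg_right (hbound s hs.1.le) (Real.exp_pos s).le
      _ = G * (Real.exp t - Real.exp T) := by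
          rw [intervalIntegral.integral_const_mul, integral_exp]
      _ ≤ G * Real.exp t :=
          mul_le_mul_of_nonneg_left (by linarith [Real.exp_pos T]) hG0
  have hmul : Real.exp (-t) * (G * Real.exp t) = G := by
    rw [mul_left_comm, ← Real.exp_add]
    simp
  rw [hfactor, abs_mul, Real.abs_exp]
  calc Real.exp (-t) * |C + ∫ s in T..t, Real.exp s * g s|
      ≤ Real.exp (-t) * (|C| + G * Real.exp t) := by
        gcongr
        exact (abs_add_le _ _).trans (by gcongr)
    _ = Real.exp (-t) * |C| + G := by rw [mul_add, hmul]
    _ ≤ H := by linarith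

/-- A continuous function is nearly bounded by its maximum modulus on `[-X, X]` on a slightly
larger interval. -/
theorem exists_pos_abs_le_sSup_add {f : ℝ → ℝ} (hf : Continuous f) {X ε : ℝ} (hX : 0 ≤ X)
    (hε : 0 < ε) :
    ∃ δ > 0, ∀ u, |u| ≤ X + δ → |f u| ≤ sSup ((fun y => |f y|) '' Icc (-X) X) + ε := by
  set M := sSup ((fun y => |f y|) '' Icc (-X) X)
  have hopen : IsOpen {u | |f u| < M + ε} := isOpen_lt hf.abs continuous_const
  have hsub : Metric.closedBall (0 : ℝ) X ⊆ {u | |f u| < M + ε} := by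
    intro u hu
    have hmem : u ∈ Icc (-X) X := by
      rwa [mem_closedBall_zero_iff, Real.norm_eq_abs, abs_le] at hu
    have hle : |f u| ≤ M :=
      le_csSup (isCompact_Icc.image hf.abs).bddAbove (mem_image_of_mem _ hmem)
    exact hle.trans_lt (by linarith)
  obtain ⟨δ, hδ, hthick⟩ :=
    (isCompact_closedBall (0 : ℝ) X).exists_cthickening_subset_open hopen hsub
  refine ⟨δ, hδ, fun u hu => le_of_lt (hthick ?_)⟩
  rw [cthickening_closedBall hδ.le hX, mem_closedBall_zero_iff, Real.norm_eq_abs]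
  linarith

/-- If `x` is continuous with `X* = limsup_{t→∞} |x(t)| < ∞` and
`y(t) = x(t) − x(0)e^{−t} − ∫_0^t e^{−(t−s)}(x(s) − f(x(s))) ds`, then
`limsup_{t→∞} |y(t)| ≤ 2X* + max_{|u| ≤ X*} |f(u)| = h_f(X*)`. -/
theorem stmt_17 (f : ℝ → ℝ) (hc : Continuous f)
    (x : ℝ → ℝ) (hx : ContinuousOn x (Set.Ici 0))
    (Xstar : ℝ)
    (hX : Filter.limsup (fun t : ℝ => ((|x t| : ℝ) : EReal)) Filter.atTop =
      ((Xstar : ℝ) : EReal))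
    (y : ℝ → ℝ)
    (hy : ∀ t : ℝ, y t = x t - x 0 * Real.exp (-t) -
      ∫ s in (0 : ℝ)..t, Real.exp (-(t - s)) * (x s - f (x s))) :
    Filter.limsup (fun t : ℝ => ((|y t| : ℝ) : EReal)) Filter.atTop ≤
      ((hfun f Xstar : ℝ) : EReal) := by
  have hX0 : 0 ≤ Xstar := by
    rw [← EReal.coe_le_coe_iff, ← hX]
    exact le_limsup_of_frequently_le
      (Eventually.of_forall fun t => EReal.coe_le_coe_iff.2 (abs_nonneg (x t))).frequently
  have hxle : ∀ δ > 0, ∀ᶠ t in atTop, |x t| ≤ Xstar + δ := by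
    intro δ hδ
    have hlt : limsup (fun t : ℝ => ((|x t| : ℝ) : EReal)) atTop <
        ((Xstar + δ : ℝ) : EReal) := by
      rw [hX, EReal.coe_lt_coe_iff]
      linarith
    filter_upwards [eventually_lt_of_limsup_lt hlt] with t ht
    exact (EReal.coe_lt_coe_iff.1 ht).le
  refine EReal.le_of_forall_lt_iff_le.1 fun b hb => ?_
  rw [EReal.coe_lt_coe_iff] at hb
  refine limsup_le_of_le (by isBoundedDefault) ?_
  obtain ⟨ε, hε, hεb⟩ : ∃ ε > 0, hfun f Xstar + 5 * ε = b :=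
    ⟨(b - hfun f Xstar) / 5, by linarith, by ring⟩
  obtain ⟨δ, hδ, hfδ⟩ := exists_pos_abs_le_sSup_add hc hX0 hε
  unfold hfun at hεb
  set M := sSup ((fun y => |f y|) '' Icc (-Xstar) Xstar)
  have hg : ContinuousOn (fun s => x s - f (x s)) (Ici 0) :=
    hx.sub (hc.comp_continuousOn hx)
  have hgle : ∀ᶠ t in atTop, |x t - f (x t)| ≤ Xstar + M + 2 * ε := by
    filter_upwards [hxle δ hδ, hxle ε hε] with t ht₁ ht₂
    linarith [abs_sub (x t) (f (x t)), hfδ _ ht₁]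
  have hlim : Tendsto (fun t : ℝ => |x 0| * Real.exp (-t)) atTop (𝓝 0) := by
    simpa using Real.tendsto_exp_neg_atTop_nhds_zero.const_mul |x 0|
  filter_upwards [hxle ε hε, hlim.eventually_lt_const hε,
    eventually_abs_integral_exp_mul_le hg hgle
      (show Xstar + M + 2 * ε < Xstar + M + 3 * ε by linarith)] with t hxt h0 hint
  rw [EReal.coe_le_coe_iff, hy]
  have h0' : |x 0 * Real.exp (-t)| < ε := by rwa [abs_mul, Real.abs_exp]
  rw [abs_le] at *
  rw [abs_lt] at h0'
  constructor <;> linarith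
end

section
/- Let f : ℝ → ℝ be continuous and suppose there exists K ∈ ℝ such that (f(x) − f(y))·(x − y) ≥ −K·(x − y)² for all x, y ∈ ℝ. If x₁, x₂ : [0,∞) → ℝ are continuous functions satisfying x₁(t) − x₂(t) = −∫_0^t (f(x₁(s)) − f(x₂(s))) ds for all t ≥ 0, then x₁(t) = x₂(t) for all t ≥ 0. -/
/-- If `f` is continuous and satisfies the one-sided Lipschitz condition
`(f(x) − f(y))·(x − y) ≥ −K(x − y)²`, and `x₁, x₂` are continuous on `[0,∞)` with
`x₁(t) − x₂(t) = −∫_0^t (f(x₁(s)) − f(x₂(s))) ds` for all `t ≥ 0`, then `x₁ = x₂`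
on `[0,∞)`. -/
theorem stmt_18 (f : ℝ → ℝ) (hc : Continuous f) (K : ℝ)
    (hK : ∀ x y : ℝ, -(K * (x - y) ^ 2) ≤ (f x - f y) * (x - y))
    (x₁ x₂ : ℝ → ℝ)
    (h₁ : ContinuousOn x₁ (Set.Ici 0)) (h₂ : ContinuousOn x₂ (Set.Ici 0))
    (heq : ∀ t : ℝ, 0 ≤ t →
      x₁ t - x₂ t = -∫ s in (0 : ℝ)..t, (f (x₁ s) - f (x₂ s))) :
    ∀ t : ℝ, 0 ≤ t → x₁ t = x₂ t := by
  set g : ℝ → ℝ := fun s ↦ f (x₁ s) - f (x₂ s)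
  have hg : ContinuousOn g (Set.Ici 0) :=
    (hc.comp_continuousOn h₁).sub (hc.comp_continuousOn h₂)
  have hderiv : ∀ t : ℝ, 0 < t → HasDerivAt (fun s ↦ x₁ s - x₂ s) (-g t) t := by
    intro t ht
    have hint : IntervalIntegrable g MeasureTheory.volume 0 t :=
      (hg.mono (by rw [Set.uIcc_of_le ht.le]; exact Set.Icc_subset_Ici_self)).intervalIntegrable
    have hmeas : StronglyMeasurableAtFilter g (nhds t) MeasureTheory.volume :=
      (hg.mono Set.Ioi_subset_Ici_self).stronglyMeasurableAtFilter isOpen_Ioi t ht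
    have hint_deriv :=
      intervalIntegral.integral_hasDerivAt_right hint hmeas (hg.continuousAt (Ici_mem_nhds ht))
    refine hint_deriv.neg.congr_of_eventuallyEq ?_
    filter_upwards [Ici_mem_nhds ht] with s hs using heq s hs
  set w : ℝ → ℝ := fun t ↦ (x₁ t - x₂ t) ^ 2 * Real.exp (-(2 * K) * t)
  have hw : ∀ t : ℝ, 0 < t → HasDerivAt w
      (-(2 * Real.exp (-(2 * K) * t)) * (g t * (x₁ t - x₂ t) + K * (x₁ t - x₂ t) ^ 2)) t := by
    intro t ht
    refine (((hderiv t ht).fun_pow 2).fun_mul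
      ((hasDerivAt_id' t).const_mul (-(2 * K))).exp).congr_deriv ?_
    ring
  have hanti : AntitoneOn w (Set.Ici 0) := by
    refine antitoneOn_of_deriv_nonpos (convex_Ici 0) (by fun_prop) ?_ ?_
    · rw [interior_Ici]
      exact fun t ht ↦ (hw t ht).differentiableAt.differentiableWithinAt
    · rw [interior_Ici]
      intro t ht
      rw [(hw t ht).deriv]
      exact mul_nonpos_of_nonpos_of_nonneg (by linarith [Real.exp_pos (-(2 * K) * t)])
        (by linarith [hK (x₁ t) (x₂ t)])
  intro t ht
  have hw₀ : w 0 = 0 := by simp [w, heq 0 le_rfl]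
  have hwt : w t ≤ 0 := hw₀ ▸ hanti Set.self_mem_Ici ht ht
  have hsq : (x₁ t - x₂ t) ^ 2 ≤ 0 := nonpos_of_mul_nonpos_left hwt (Real.exp_pos _)
  exact sub_eq_zero.mp (pow_eq_zero_iff two_ne_zero |>.mp (hsq.antisymm (sq_nonneg _)))
end

section
/- If f₁ and f₂ are two functions each of which is continuous, vanishes at 0, satisfies x·f(x) > 0 for all x ≠ 0, and tends to +∞ at +∞ and to −∞ at −∞, and if |f₂(x)| ≥ |f₁(x)| for all x ∈ ℝ, then f₁⁺(x) ≥ f₂⁺(x) for every x > 0, and f₁⁻(y) ≤ f₂⁻(y) for every y < 0. -/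
theorem fplus_le_fplus_of_abs_le {f g : ℝ → ℝ} (hf : Continuous f)
    (hftop : Filter.Tendsto f Filter.atTop Filter.atTop) (hfg : ∀ z, |f z| ≤ |g z|)
    {x : ℝ} (hx : 0 < x) : fplus g x ≤ fplus f x := by
  have hbdd : BddAbove {z : ℝ | 0 < z ∧ f z = x} := by
    obtain ⟨b, hb⟩ := Filter.eventually_atTop.1 (hftop.eventually_gt_atTop x)
    refine ⟨b, fun z hz => ?_⟩
    by_contra! hbz
    exact (hb z hbz.le).ne' hz.2
  refine Real.sSup_le ?_ (Real.sSup_nonneg fun z hz => hz.1.le)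
  rintro z ⟨hz, hgz⟩
  have hfz : f z ≤ x := by
    simpa [hgz, abs_of_pos hx] using (le_abs_self (f z)).trans (hfg z)
  obtain ⟨b, hxb, hzb⟩ :=
    ((hftop.eventually_ge_atTop x).and (Filter.eventually_ge_atTop z)).exists
  obtain ⟨w, hw, hfw⟩ := intermediate_value_Icc hzb hf.continuousOn ⟨hfz, hxb⟩
  exact le_csSup_of_le hbdd ⟨hz.trans_le hw.1, hfw⟩ hw.1

theorem fminus_eq_neg_fplus (f : ℝ → ℝ) (y : ℝ) :
    fminus f y = -fplus (fun z => -f (-z)) (-y) := by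
  rw [fminus, fplus, Real.sInf_def]
  congr 2
  ext z
  simp

/-- If `f₁, f₂` are continuous, vanish at `0`, satisfy `x·f(x) > 0` for `x ≠ 0`, tend to
`±∞` at `±∞`, and `|f₂| ≥ |f₁|` pointwise, then `f₁⁺(x) ≥ f₂⁺(x)` for every `x > 0` and
`f₁⁻(y) ≤ f₂⁻(y)` for every `y < 0`. -/
theorem stmt_19 (f₁ f₂ : ℝ → ℝ)
    (h₁c : Continuous f₁) (h₁0 : f₁ 0 = 0) (h₁s : ∀ x : ℝ, x ≠ 0 → 0 < x * f₁ x)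
    (h₁top : Filter.Tendsto f₁ Filter.atTop Filter.atTop)
    (h₁bot : Filter.Tendsto f₁ Filter.atBot Filter.atBot)
    (h₂c : Continuous f₂) (h₂0 : f₂ 0 = 0) (h₂s : ∀ x : ℝ, x ≠ 0 → 0 < x * f₂ x)
    (h₂top : Filter.Tendsto f₂ Filter.atTop Filter.atTop)
    (h₂bot : Filter.Tendsto f₂ Filter.atBot Filter.atBot)
    (hdom : ∀ x : ℝ, |f₁ x| ≤ |f₂ x|) :
    (∀ x : ℝ, 0 < x → fplus f₂ x ≤ fplus f₁ x) ∧
    (∀ y : ℝ, y < 0 → fminus f₁ y ≤ fminus f₂ y) := by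
  refine ⟨fun x hx => fplus_le_fplus_of_abs_le h₁c h₁top hdom hx, fun y hy => ?_⟩
  rw [fminus_eq_neg_fplus, fminus_eq_neg_fplus, neg_le_neg_iff]
  refine fplus_le_fplus_of_abs_le (by fun_prop) ?_ (fun z => ?_) (neg_pos.2 hy)
  · exact Filter.tendsto_neg_atBot_atTop.comp (h₁bot.comp Filter.tendsto_neg_atTop_atBot)
  · simpa using hdom (-z)
end
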